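/- Suppose the semi-infinite block matrix g admits a Gaussian factorization S g = S̄ and is block Hänkel (g_{i+1,j} = g_{i,j+1} for all i, j). Then the second family of matrix polynomials p̄_i satisfies the three-term recurrence relation z p̄_i(z) = p̄_{i−1}(z) + (L_{ii})^† p̄_i(z) + (L_{i+1,i})^† p̄_{i+1}(z) for all i ≥ 0 (with p̄_{−1} := 0), where L_{ij} := Σ_k S_{ik} (S⁻¹)_{k+1,j} are the blocks of L = S Λ S⁻¹. -/

import Mathlib

open Matrix Finset

/-- A sum over `range m` may be extended to `range n` when the new terms vanish. -/
lemma sum_range_extend {M : Type*} [AddCommMonoid M] {f : ℕ → M} {m n : ℕ} (hmn : m ≤ n)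
    (hf : ∀ k, m ≤ k → f k = 0) : ∑ k ∈ Finset.range n, f k = ∑ k ∈ Finset.range m, f k := by
  symm
  refine Finset.sum_subset (Finset.range_mono hmn) fun k _ hk => hf k ?_
  simpa using hk

/-- Associativity of the product of a row, a matrix and a column, all of finite size. -/
lemma sum_mul_sum_mul_assoc {R : Type*} [Semiring R] (a : ℕ → R) (b : ℕ → ℕ → R) (c : ℕ → R)
    (m n : ℕ) :
    ∑ i ∈ Finset.range m, a i * ∑ j ∈ Finset.range n, b i j * c j
      = ∑ j ∈ Finset.range n, (∑ i ∈ Finset.range m, a i * b i j) * c j := by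
  simp only [Finset.mul_sum, Finset.sum_mul, mul_assoc]
  exact Finset.sum_comm

section Hankel

variable {R : Type*} [Ring R] {g S Sinv Sb Sbinv L : ℕ → ℕ → R}

/-- Multiplying the factorization `S g = Sb` by the inverse of `S` recovers `g`. -/
lemma eq_sum_of_gaussian_factorization
    (hS_tri : ∀ i j, i < j → S i j = 0)
    (hSinvS : ∀ i j, ∑ k ∈ Finset.range (i + 1), Sinv i k * S k j = if i = j then 1 else 0)
    (hfact : ∀ i j, ∑ k ∈ Finset.range (i + 1), S i k * g k j = Sb i j) (i j : ℕ) :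
    g i j = ∑ k ∈ Finset.range (i + 1), Sinv i k * Sb k j := by
  have hSb : ∀ k ∈ Finset.range (i + 1),
      Sinv i k * Sb k j = Sinv i k * ∑ l ∈ Finset.range (i + 1), S k l * g l j := by
    intro k hk
    rw [Finset.mem_range] at hk
    rw [← hfact, sum_range_extend (m := k + 1) (n := i + 1) (by omega)]
    intro l hl
    rw [hS_tri k l (by omega), zero_mul]
  rw [Finset.sum_congr rfl hSb, sum_mul_sum_mul_assoc]
  simp [hSinvS]

/-- For a block Hankel matrix, `L Sb` is `Sb` with its columns shifted. -/
lemma hankel_sum_mul_eq_shift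
    (hS_tri : ∀ i j, i < j → S i j = 0)
    (hSinv_tri : ∀ i j, i < j → Sinv i j = 0)
    (hSinvS : ∀ i j, ∑ k ∈ Finset.range (i + 1), Sinv i k * S k j = if i = j then 1 else 0)
    (hfact : ∀ i j, ∑ k ∈ Finset.range (i + 1), S i k * g k j = Sb i j)
    (hhankel : ∀ i j, g (i + 1) j = g i (j + 1))
    (hL : ∀ i j, L i j = ∑ k ∈ Finset.range (i + 1), S i k * Sinv (k + 1) j) (i j : ℕ) :
    ∑ m ∈ Finset.range (i + 2), L i m * Sb m j = Sb i (j + 1) := by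
  simp only [hL]
  rw [← sum_mul_sum_mul_assoc, ← hfact]
  refine Finset.sum_congr rfl fun k hk => ?_
  rw [Finset.mem_range] at hk
  rw [← hhankel, eq_sum_of_gaussian_factorization hS_tri hSinvS hfact,
    sum_range_extend (m := k + 1 + 1) (n := i + 2) (by omega)]
  intro l hl
  rw [hSinv_tri (k + 1) l (by omega), zero_mul]

lemma conj_shift_eq_zero
    (hSinv_tri : ∀ i j, i < j → Sinv i j = 0)
    (hL : ∀ i j, L i j = ∑ k ∈ Finset.range (i + 1), S i k * Sinv (k + 1) j)
    {i j : ℕ} (hij : i + 1 < j) : L i j = 0 := by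
  rw [hL]
  refine Finset.sum_eq_zero fun k hk => ?_
  rw [Finset.mem_range] at hk
  rw [hSinv_tri (k + 1) j (by omega), mul_zero]

lemma conj_shift_superdiag
    (hS_diag : ∀ i, S i i = 1)
    (hSinv_diag : ∀ i, Sinv i i = 1)
    (hSinv_tri : ∀ i j, i < j → Sinv i j = 0)
    (hL : ∀ i j, L i j = ∑ k ∈ Finset.range (i + 1), S i k * Sinv (k + 1) j)
    (i : ℕ) : L i (i + 1) = 1 := by
  rw [hL, Finset.sum_range_succ, hS_diag, hSinv_diag, Finset.sum_eq_zero, zero_add, one_mul]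
  intro k hk
  rw [Finset.mem_range] at hk
  rw [hSinv_tri (k + 1) (i + 1) (by omega), mul_zero]

/-- For a block Hankel matrix, `L = S Λ S⁻¹` is also equal to `Sb Λᵀ Sb⁻¹`. -/
lemma hankel_conj_shift_eq
    (hS_tri : ∀ i j, i < j → S i j = 0)
    (hSinv_tri : ∀ i j, i < j → Sinv i j = 0)
    (hSinvS : ∀ i j, ∑ k ∈ Finset.range (i + 1), Sinv i k * S k j = if i = j then 1 else 0)
    (hSbSbinv : ∀ i j, ∑ k ∈ Finset.range (j + 1), Sb i k * Sbinv k j = if i = j then 1 else 0)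
    (hfact : ∀ i j, ∑ k ∈ Finset.range (i + 1), S i k * g k j = Sb i j)
    (hhankel : ∀ i j, g (i + 1) j = g i (j + 1))
    (hL : ∀ i j, L i j = ∑ k ∈ Finset.range (i + 1), S i k * Sinv (k + 1) j) (i n : ℕ) :
    L i n = ∑ j ∈ Finset.range (n + 1), Sb i (j + 1) * Sbinv j n := by
  simp only [← hankel_sum_mul_eq_shift hS_tri hSinv_tri hSinvS hfact hhankel hL]
  rw [← sum_mul_sum_mul_assoc]
  simp only [hSbSbinv, mul_ite, mul_one, mul_zero, Finset.sum_ite_eq', Finset.mem_range]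
  split_ifs with h
  · rfl
  · exact conj_shift_eq_zero hSinv_tri hL (by omega)

/-- For a block Hankel matrix, `Sb⁻¹ L` is `Sb⁻¹` with its rows shifted down. -/
lemma hankel_sum_inv_mul
    (hS_tri : ∀ i j, i < j → S i j = 0)
    (hSinv_tri : ∀ i j, i < j → Sinv i j = 0)
    (hSinvS : ∀ i j, ∑ k ∈ Finset.range (i + 1), Sinv i k * S k j = if i = j then 1 else 0)
    (hSb_tri : ∀ i j, j < i → Sb i j = 0)
    (hSbSbinv : ∀ i j, ∑ k ∈ Finset.range (j + 1), Sb i k * Sbinv k j = if i = j then 1 else 0)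
    (hSbinvSb : ∀ i j, ∑ k ∈ Finset.range (j + 1), Sbinv i k * Sb k j = if i = j then 1 else 0)
    (hfact : ∀ i j, ∑ k ∈ Finset.range (i + 1), S i k * g k j = Sb i j)
    (hhankel : ∀ i j, g (i + 1) j = g i (j + 1))
    (hL : ∀ i j, L i j = ∑ k ∈ Finset.range (i + 1), S i k * Sinv (k + 1) j) (l n : ℕ) :
    ∑ i ∈ Finset.range (n + 2), Sbinv l i * L i n
      = ∑ j ∈ Finset.range (n + 1), (if l = j + 1 then 1 else 0) * Sbinv j n := by
  simp only [hankel_conj_shift_eq hS_tri hSinv_tri hSinvS hSbSbinv hfact hhankel hL]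
  rw [sum_mul_sum_mul_assoc]
  refine Finset.sum_congr rfl fun j hj => ?_
  rw [Finset.mem_range] at hj
  rw [← hSbinvSb, sum_range_extend (m := j + 1 + 1) (n := n + 2) (by omega)]
  intro i hi
  rw [hSb_tri i (j + 1) (by omega), mul_zero]

end Hankel

/-- If g admits a Gaussian factorization S g = S̄ and is block Hänkel,
then the second family p̄_j(z) = Σ_{l≤j} ((S̄⁻¹)_{lj})^† z^l satisfies the three-term
recurrence z p̄_i(z) = p̄_{i−1}(z) + (L_{ii})^† p̄_i(z) + (L_{i+1,i})^† p̄_{i+1}(z)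
(with p̄_{−1} := 0), where L_{ij} = Σ_k S_{ik} (S⁻¹)_{k+1,j}. The case i = 0 and the
cases i ≥ 1 are stated separately so that p̄_{−1} = 0 is built in. -/
theorem hankel_three_term_recurrence_dual
    (N : ℕ) (hN : 1 ≤ N)
    (g S Sinv Sb Sbinv : ℕ → ℕ → Matrix (Fin N) (Fin N) ℂ)
    -- S is block lower unitriangular
    (hS_diag : ∀ i, S i i = 1)
    (hS_tri : ∀ i j, i < j → S i j = 0)
    -- with block lower unitriangular two-sided inverse S⁻¹
    (hSinv_diag : ∀ i, Sinv i i = 1)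
    (hSinv_tri : ∀ i j, i < j → Sinv i j = 0)
    (hSSinv : ∀ i j, ∑ k ∈ Finset.range (i + 1), S i k * Sinv k j
      = if i = j then 1 else 0)
    (hSinvS : ∀ i j, ∑ k ∈ Finset.range (i + 1), Sinv i k * S k j
      = if i = j then 1 else 0)
    -- S̄ is block upper triangular with invertible diagonal blocks
    (hSb_tri : ∀ i j, j < i → Sb i j = 0)
    (hSb_diag : ∀ i, IsUnit (Sb i i))
    -- with block upper triangular two-sided inverse S̄⁻¹
    (hSbinv_tri : ∀ i j, j < i → Sbinv i j = 0)
    (hSbSbinv : ∀ i j, ∑ k ∈ Finset.range (j + 1), Sb i k * Sbinv k j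
      = if i = j then 1 else 0)
    (hSbinvSb : ∀ i j, ∑ k ∈ Finset.range (j + 1), Sbinv i k * Sb k j
      = if i = j then 1 else 0)
    -- the factorization S g = S̄
    (hfact : ∀ i j, ∑ k ∈ Finset.range (i + 1), S i k * g k j = Sb i j)
    -- g is block Hänkel
    (hhankel : ∀ i j, g (i + 1) j = g i (j + 1))
    -- p̄_j(z) = Σ_{l≤j} ((S̄⁻¹)_{lj})^† z^l
    (pbar : ℕ → ℂ → Matrix (Fin N) (Fin N) ℂ)
    (hpbar : ∀ j z, pbar j z = ∑ l ∈ Finset.range (j + 1), ((z : ℂ) ^ l) • (Sbinv l j)ᴴ)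
    -- L_{ij} = Σ_k S_{ik} (S⁻¹)_{k+1,j}
    (L : ℕ → ℕ → Matrix (Fin N) (Fin N) ℂ)
    (hL : ∀ i j, L i j = ∑ k ∈ Finset.range (i + 1), S i k * Sinv (k + 1) j) :
    (∀ z, z • pbar 0 z = (L 0 0)ᴴ * pbar 0 z + (L 1 0)ᴴ * pbar 1 z)
    ∧ (∀ i z, z • pbar (i + 1) z
        = pbar i z + (L (i + 1) (i + 1))ᴴ * pbar (i + 1) z
          + (L (i + 2) (i + 1))ᴴ * pbar (i + 2) z) := by
  have hshift := hankel_sum_inv_mul hS_tri hSinv_tri hSinvS hSb_tri hSbSbinv hSbinvSb hfact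
    hhankel hL
  have hrec : ∀ n z, z • pbar n z = ∑ i ∈ Finset.range (n + 2), (L i n)ᴴ * pbar i z := by
    intro n z
    have hext : ∀ i ∈ Finset.range (n + 2), (L i n)ᴴ * pbar i z
        = ∑ l ∈ Finset.range (n + 2), z ^ l • (Sbinv l i * L i n)ᴴ := by
      intro i hi
      rw [Finset.mem_range] at hi
      rw [hpbar, Finset.mul_sum, sum_range_extend (m := i + 1) (n := n + 2) (by omega)]
      · simp only [conjTranspose_mul, Matrix.mul_smul]
      · intro l hl
        rw [hSbinv_tri l i (by omega), zero_mul, conjTranspose_zero, smul_zero]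
    rw [Finset.sum_congr rfl hext, Finset.sum_comm]
    simp only [← Finset.smul_sum, ← conjTranspose_sum, hshift]
    rw [Finset.sum_range_succ', hpbar, Finset.smul_sum]
    have hzero : ∑ j ∈ Finset.range (n + 1),
        (if 0 = j + 1 then (1 : Matrix (Fin N) (Fin N) ℂ) else 0) * Sbinv j n = 0 :=
      Finset.sum_eq_zero fun j _ => by simp
    rw [hzero, conjTranspose_zero, smul_zero, add_zero]
    refine Finset.sum_congr rfl fun l hl => ?_
    have hsingle : ∑ j ∈ Finset.range (n + 1),
        (if l + 1 = j + 1 then (1 : Matrix (Fin N) (Fin N) ℂ) else 0) * Sbinv j n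
          = Sbinv l n := by
      rw [Finset.sum_eq_single_of_mem l hl fun j _ hj => by simp [hj.symm]]
      simp
    rw [hsingle, smul_smul, pow_succ']
  refine ⟨fun z => ?_, fun n z => ?_⟩
  · rw [hrec, Finset.sum_range_succ, Finset.sum_range_one]
  · rw [hrec, Finset.sum_range_succ, Finset.sum_range_succ, Finset.sum_range_succ,
      conj_shift_superdiag hS_diag hSinv_diag hSinv_tri hL, conjTranspose_one, one_mul,
      Finset.sum_eq_zero, zero_add]
    intro i hi
    rw [Finset.mem_range] at hi
    rw [conj_shift_eq_zero hSinv_tri hL (by omega), conjTranspose_zero, zero_mul]
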